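/- arXiv:0807.4497 — 3 statements merged into one kernel-verified Lean document; each statement's English description precedes it below -/
import Mathlib

section
/- Let k ≥ 2 and let a = (a_1,…,a_k) ∈ ℝ^k lie in the interior of the cone 𝔑, i.e. a_j > 2(a_{j+1} + ⋯ + a_k) for all j = 1,…,k−1 and a_k > 0. Then for every s = 1,…,k−1 and every point (x_s,…,x_{k−1}) ∈ [0,1]^{k−s}, one has θ_s^k(x_s,…,x_{k−1}; a) > 0. -/
open Finset

/-- The 2×2 matrix `R(x)` with rows `(1−x, x)` and `(x, 1−x)`. -/
noncomputable def Rm (x : ℝ) : Matrix (Fin 2) (Fin 2) ℝ := !![1 - x, x; x, 1 - x]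

/-- The 2×2 matrix `T` with rows `(1, −1)` and `(0, 1)`. -/
noncomputable def Tm : Matrix (Fin 2) (Fin 2) ℝ := !![1, -1; 0, 1]

/-- Auxiliary product: `Maux x q n = R(x_{q+n})·T ⋯ R(x_q)·T`. -/
noncomputable def Maux (x : ℕ → ℝ) (q : ℕ) : ℕ → Matrix (Fin 2) (Fin 2) ℝ
  | 0 => Rm (x q) * Tm
  | n + 1 => Rm (x (q + n + 1)) * Tm * Maux x q n

/-- `Mpq x p q = M_{p,q}(x_q,…,x_p) = R(x_p)·T·R(x_{p−1})·T ⋯ R(x_q)·T` (for `q ≤ p`). -/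
noncomputable def Mpq (x : ℕ → ℝ) (p q : ℕ) : Matrix (Fin 2) (Fin 2) ℝ := Maux x q (p - q)

/-- `α_{p,q} = (M_{p,q})₂₂`. -/
noncomputable def alphaPQ (x : ℕ → ℝ) (p q : ℕ) : ℝ := Mpq x p q 1 1

/-- `β_{p,q} = (M_{p,q})₂₁`. -/
noncomputable def betaPQ (x : ℕ → ℝ) (p q : ℕ) : ℝ := Mpq x p q 1 0

/-- `γ_{p,q} = (M_{p,q})₁₂`. -/
noncomputable def gammaPQ (x : ℕ → ℝ) (p q : ℕ) : ℝ := Mpq x p q 0 1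

/-- `δ_{p,q} = (M_{p,q})₁₁`. -/
noncomputable def deltaPQ (x : ℕ → ℝ) (p q : ℕ) : ℝ := Mpq x p q 0 0

/-- `y_{p,q} = α_{p,q} − β_{p,q}`. -/
noncomputable def yPQ (x : ℕ → ℝ) (p q : ℕ) : ℝ := alphaPQ x p q - betaPQ x p q

/-- `w_{p,q} = α_{p,q} + β_{p,q}`. -/
noncomputable def wPQ (x : ℕ → ℝ) (p q : ℕ) : ℝ := alphaPQ x p q + betaPQ x p q

/-- `θ_s^k(x_s,…,x_{k−1}; a) = a_s + Σ_{j=s}^{k−1} a_{j+1}·y_{j,s}`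
(for `k = s` this is just `a_s`). -/
noncomputable def theta (x a : ℕ → ℝ) (k s : ℕ) : ℝ :=
  a s + ∑ j ∈ Finset.Icc s (k - 1), a (j + 1) * yPQ x j s

theorem Maux_succ_eq_mul_first (x : ℕ → ℝ) (q n : ℕ) :
    Maux x q (n + 1) = Maux x (q + 1) n * (Rm (x q) * Tm) := by
  induction n with
  | zero => rfl
  | succ n ih =>
    rw [Maux, ih, Maux, show q + (n + 1) + 1 = q + 1 + n + 1 by omega]
    simp only [Matrix.mul_assoc]

/-- The second row of `a_s • 1 + ∑ j < n, a_{s+j+1} • M_{s+j,s}`. -/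
noncomputable def weightedRow (x a : ℕ → ℝ) (n s : ℕ) (i : Fin 2) : ℝ :=
  a s * (1 : Matrix (Fin 2) (Fin 2) ℝ) 1 i +
    ∑ j ∈ Finset.range n, a (s + j + 1) * Maux x s j 1 i

theorem weightedRow_succ (x a : ℕ → ℝ) (n s : ℕ) (i : Fin 2) :
    weightedRow x a (n + 1) s i = a s * (1 : Matrix (Fin 2) (Fin 2) ℝ) 1 i +
      (weightedRow x a n (s + 1) 0 * (Rm (x s) * Tm) 0 i +
        weightedRow x a n (s + 1) 1 * (Rm (x s) * Tm) 1 i) := by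
  unfold weightedRow
  rw [Finset.sum_range_succ']
  simp only [Maux_succ_eq_mul_first, Matrix.mul_apply (M := Maux _ _ _), Fin.sum_univ_two,
    Maux.eq_1, mul_add, add_mul, Finset.sum_add_distrib, Finset.sum_mul]
  simp [mul_assoc, add_comm, add_left_comm]

theorem weightedRow_succ_zero (x a : ℕ → ℝ) (n s : ℕ) :
    weightedRow x a (n + 1) s 0 =
      weightedRow x a n (s + 1) 0 * (1 - x s) + weightedRow x a n (s + 1) 1 * x s := by
  simp [weightedRow_succ, Rm, Tm]

theorem weightedRow_succ_one (x a : ℕ → ℝ) (n s : ℕ) :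
    weightedRow x a (n + 1) s 1 = a s + weightedRow x a n (s + 1) 0 * (2 * x s - 1) +
      weightedRow x a n (s + 1) 1 * (1 - 2 * x s) := by
  simp [weightedRow_succ, Rm, Tm]
  ring

/-- The bounds propagated by downward induction on the starting index `s`. -/
theorem weightedRow_bounds (x a : ℕ → ℝ) (n s : ℕ)
    (ha : ∀ j, s ≤ j → j < s + n → 2 * ∑ l ∈ Finset.Icc (j + 1) (s + n), a l < a j)
    (hpos : 0 < a (s + n))
    (hx : ∀ i, s ≤ i → i < s + n → x i ∈ Set.Icc (0 : ℝ) 1) :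
    0 ≤ weightedRow x a n s 0 ∧ weightedRow x a n s 0 < weightedRow x a n s 1 ∧
      2 * weightedRow x a n s 1 - weightedRow x a n s 0 ≤
        2 * ∑ l ∈ Finset.Icc s (s + n), a l := by
  induction n generalizing s with
  | zero => simpa [weightedRow] using hpos
  | succ n ih =>
    have hk : s + (n + 1) = s + 1 + n := by omega
    rw [hk] at ha hpos hx ⊢
    obtain ⟨h₀, h₁, h₂⟩ := ih (s + 1) (fun j hj => ha j (by omega)) hpos
      (fun i hi => hx i (by omega))
    obtain ⟨hx₀, hx₁⟩ := hx s le_rfl (by omega)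
    have has := ha s le_rfl (by omega)
    have hsum : ∑ l ∈ Finset.Icc s (s + 1 + n), a l =
        a s + ∑ l ∈ Finset.Icc (s + 1) (s + 1 + n), a l := by
      rw [← Finset.insert_Icc_add_one_left_eq_Icc (by omega : s ≤ s + 1 + n),
        Finset.sum_insert (by simp)]
    rw [hsum, weightedRow_succ_zero, weightedRow_succ_one]
    have hxd := mul_nonneg hx₀ (sub_nonneg.2 h₁.le)
    have hxd' := mul_nonneg (sub_nonneg.2 hx₁) (sub_nonneg.2 h₁.le)
    refine ⟨?_, ?_, ?_⟩ <;> linarith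

theorem theta_eq_weightedRow (x a : ℕ → ℝ) (n s : ℕ) (hn : 1 ≤ n) :
    theta x a (s + n) s = weightedRow x a n s 1 - weightedRow x a n s 0 := by
  have hIcc : Finset.Icc s (s + n - 1) = Finset.Ico s (s + n) := by
    ext j
    simp only [Finset.mem_Icc, Finset.mem_Ico]
    omega
  simp [theta, weightedRow, hIcc, Finset.sum_Ico_eq_sum_range, yPQ, alphaPQ, betaPQ, Mpq,
    mul_sub, add_sub_assoc]

/-- If `a` lies in the interior of the cone 𝔑 ⊂ ℝ^k, then every vertical eigenvalue
function θ_s^k is positive on the cube [0,1]^{k−s}. -/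
theorem stmt0 (k : ℕ) (hk : 2 ≤ k) (a : ℕ → ℝ)
    (ha₁ : ∀ j, 1 ≤ j → j ≤ k - 1 → 2 * ∑ l ∈ Finset.Icc (j + 1) k, a l < a j)
    (ha₂ : 0 < a k)
    (s : ℕ) (hs₁ : 1 ≤ s) (hs₂ : s ≤ k - 1)
    (x : ℕ → ℝ) (hx : ∀ i, s ≤ i → i ≤ k - 1 → x i ∈ Set.Icc (0 : ℝ) 1) :
    0 < theta x a k s := by
  obtain ⟨n, rfl⟩ : ∃ n, k = s + n := ⟨k - s, by omega⟩
  rw [theta_eq_weightedRow x a n s (by omega), sub_pos]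
  exact (weightedRow_bounds x a n s (fun j h₁ h₂ => ha₁ j (by omega) (by omega)) ha₂
    (fun i h₁ h₂ => hx i h₁ (by omega))).2.1
end

section
/- For all integers p ≥ q ≥ 1 and all real numbers x_q,…,x_p, the upper-row entries of the matrix product M_{p,q} satisfy γ_{p,q}(x_q,…,x_p) = − Σ_{h=q}^{p} α_{h,q}(x_q,…,x_h) and δ_{p,q}(x_q,…,x_p) = 1 − Σ_{h=q}^{p} β_{h,q}(x_q,…,x_h). -/
open Finset

/-- `R(x)` preserves column sums and `T` sends `(u, v)` to `(u - v, v)`, so the column sums of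
`R(x) * T * M` are the upper-row entries of `M`. -/
lemma Rm_mul_Tm_mul_zero_apply (x : ℝ) (M : Matrix (Fin 2) (Fin 2) ℝ) (j : Fin 2) :
    (Rm x * Tm * M) 0 j = M 0 j - (Rm x * Tm * M) 1 j := by
  simp only [Rm, Tm, Matrix.mul_apply, Fin.sum_univ_two, Matrix.of_apply, Matrix.cons_val_zero,
    Matrix.cons_val_one, Matrix.cons_val', Matrix.cons_val_fin_one]
  ring

lemma Mpq_self (x : ℕ → ℝ) (q : ℕ) : Mpq x q q = Rm (x q) * Tm * 1 := by
  simp [Mpq, Maux]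

lemma Mpq_succ (x : ℕ → ℝ) {p q : ℕ} (h : q ≤ p) :
    Mpq x (p + 1) q = Rm (x (p + 1)) * Tm * Mpq x p q := by
  rw [Mpq, Mpq, Nat.succ_sub h, Maux, Nat.add_sub_cancel' h]

/-- Each upper-row entry of `M_{p,q}` is the corresponding entry of the identity matrix minus the
sum of the lower-row entries of the `M_{h,q}` in the same column. -/
lemma Mpq_zero_apply (x : ℕ → ℝ) {p q : ℕ} (h : q ≤ p) (j : Fin 2) :
    Mpq x p q 0 j = (1 : Matrix (Fin 2) (Fin 2) ℝ) 0 j - ∑ i ∈ Finset.Icc q p, Mpq x i q 1 j := by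
  induction p, h using Nat.le_induction with
  | base => rw [Finset.Icc_self, Finset.sum_singleton, Mpq_self, Rm_mul_Tm_mul_zero_apply]
  | succ p h ih =>
    rw [Finset.sum_Icc_succ_top (by omega), Mpq_succ x h, Rm_mul_Tm_mul_zero_apply, ih]
    ring

/-- Closed formulas for the upper-row entries of `M_{p,q}`:
`γ_{p,q} = −Σ_{h=q}^p α_{h,q}` and `δ_{p,q} = 1 − Σ_{h=q}^p β_{h,q}`. -/
theorem stmt4 (p q : ℕ) (hq : 1 ≤ q) (hpq : q ≤ p) (x : ℕ → ℝ) :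
    gammaPQ x p q = -∑ h ∈ Finset.Icc q p, alphaPQ x h q ∧
    deltaPQ x p q = 1 - ∑ h ∈ Finset.Icc q p, betaPQ x h q := by
  constructor
  · simpa [gammaPQ, alphaPQ] using Mpq_zero_apply x hpq 1
  · simpa [deltaPQ, betaPQ] using Mpq_zero_apply x hpq 0
end

section
/- Let k ≥ 2 and let a = (a_1,…,a_k) ∈ ℝ^k lie in the interior of the cone 𝔑 ⊂ ℝ^k. Then both weights b' = (a_1, …, a_{k−2}, a_{k−1}+a_k) ∈ ℝ^{k−1} and b'' = (a_1−a_k, a_2−a_k, …, a_{k−2}−a_k, a_{k−1}−2a_k) ∈ ℝ^{k−1} lie in the interior of the cone 𝔑 ⊂ ℝ^{k−1}. -/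
open Finset

/-- Membership in the interior of the cone `𝔑 ⊂ ℝ^k`: `a_j > 2(a_{j+1} + ⋯ + a_k)` for
all `j = 1,…,k−1` and `a_k > 0` (strict inequalities). -/
def inIntConeN (k : ℕ) (a : ℕ → ℝ) : Prop :=
  (∀ j, 1 ≤ j → j ≤ k - 1 → 2 * ∑ l ∈ Finset.Icc (j + 1) k, a l < a j) ∧ 0 < a k

/-- If `a ∈ int 𝔑 ⊂ ℝ^k` (`k ≥ 2`), then both modified weights
`b' = (a_1,…,a_{k−2}, a_{k−1}+a_k)` and `b'' = (a_1−a_k,…,a_{k−2}−a_k, a_{k−1}−2a_k)`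
lie in `int 𝔑 ⊂ ℝ^{k−1}`. -/
theorem stmt13 (k : ℕ) (hk : 2 ≤ k) (a : ℕ → ℝ) (ha : inIntConeN k a) :
    inIntConeN (k - 1) (fun j => if j = k - 1 then a (k - 1) + a k else a j) ∧
    inIntConeN (k - 1) (fun j => if j = k - 1 then a (k - 1) - 2 * a k else a j - a k) := by
  obtain ⟨n, rfl⟩ : ∃ n, k = n + 2 := ⟨k - 2, by omega⟩
  obtain ⟨h, hpos⟩ := ha
  have hlast := h (n + 1) (by omega) (by omega)
  simp only [Finset.Icc_self, Finset.sum_singleton] at hlast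
  simp only [inIntConeN, show n + 2 - 1 = n + 1 from rfl, show n + 1 - 1 = n from rfl, if_true]
  have hne : ∀ j l : ℕ, l ∈ Finset.Icc (j + 1) n → l ≠ n + 1 := by
    intro j l hl
    rw [Finset.mem_Icc] at hl
    omega
  refine ⟨⟨fun j hj hjn => ?_, by linarith⟩, ⟨fun j hj hjn => ?_, by linarith⟩⟩
  all_goals
    have hsum := h j hj (by omega)
    rw [Finset.sum_Icc_succ_top (by omega), Finset.sum_Icc_succ_top (by omega)] at hsum
    rw [Finset.sum_Icc_succ_top (by omega), if_pos rfl, if_neg (by omega)]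
  · rw [Finset.sum_congr rfl fun l hl => if_neg (hne j l hl)]
    linarith
  · rw [Finset.sum_congr rfl fun l hl => if_neg (hne j l hl)]
    have hle : ∑ l ∈ Finset.Icc (j + 1) n, (a l - a (n + 2)) ≤ ∑ l ∈ Finset.Icc (j + 1) n, a l :=
      Finset.sum_le_sum fun l _ => by linarith
    linarith
end
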